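/- arXiv:1805.10386 — 5 statements merged into one kernel-verified Lean document; each statement's English description precedes it below -/
import Mathlib

section
/- For every ρ > 0 and every β with 0 < β < 1, the inequality ln(1 + ρ) − ln(1 + ρβ) ≥ e^{1/ρ} Γ(0, 1/ρ) − e^{1/(ρβ)} Γ(0, 1/(ρβ)) holds, where Γ(0, z) = ∫_z^∞ t^{-1} e^{-t} dt. -/
open Real MeasureTheory

/-- The upper incomplete gamma function at first argument `0`:
`Γ(0, z) = ∫ t in (z, ∞), t⁻¹ e^{-t} dt`, i.e. the exponential integral `E₁(z)`. -/
noncomputable def Gamma0 (z : ℝ) : ℝ := ∫ t in Set.Ioi z, t⁻¹ * Real.exp (-t)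

/-- The integrand of `Gamma0` is integrable on `(z, ∞)` for `z > 0`. -/
theorem integrableOn_Gamma0 {z : ℝ} (hz : 0 < z) :
    IntegrableOn (fun t : ℝ => t⁻¹ * Real.exp (-t)) (Set.Ioi z) := by
  refine Integrable.mono' ((integrableOn_exp_neg_Ioi z).const_mul z⁻¹) ?_ ?_
  · exact Measurable.aestronglyMeasurable (by fun_prop)
  · filter_upwards [ae_restrict_mem measurableSet_Ioi] with t ht
    have htz : z < t := ht
    have ht0 : 0 < t := hz.trans htz
    rw [Real.norm_of_nonneg (by positivity)]
    gcongr

/-- `Γ(0, z)` is differentiable for `z > 0` with derivative `-z⁻¹ e^{-z}`. -/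
theorem hasDerivAt_Gamma0 {z : ℝ} (hz : 0 < z) :
    HasDerivAt Gamma0 (-(z⁻¹ * Real.exp (-z))) z := by
  have hcont : ∀ t : ℝ, 0 < t → ContinuousAt (fun t : ℝ => t⁻¹ * Real.exp (-t)) t := by
    intro t ht
    exact (continuousAt_inv₀ ht.ne').mul (by fun_prop)
  have hint : ∀ y : ℝ, 0 < y →
      IntervalIntegrable (fun t : ℝ => t⁻¹ * Real.exp (-t)) volume 1 y := by
    intro y hy
    refine ContinuousOn.intervalIntegrable fun t ht => (hcont t ?_).continuousWithinAt
    exact (lt_min one_pos hy).trans_le ht.1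
  have hd : HasDerivAt (fun y => ∫ t in (1 : ℝ)..y, t⁻¹ * Real.exp (-t))
      (z⁻¹ * Real.exp (-z)) z :=
    intervalIntegral.integral_hasDerivAt_right (hint z hz)
      (Measurable.stronglyMeasurable (by fun_prop)).stronglyMeasurableAtFilter (hcont z hz)
  refine (hd.const_sub (Gamma0 1)).congr_of_eventuallyEq ?_
  filter_upwards [lt_mem_nhds hz] with y hy
  have := intervalIntegral.integral_interval_add_Ioi
    (integrableOn_Gamma0 one_pos) (integrableOn_Gamma0 hy)
  simp only [Gamma0]
  linarith

/-- The lower bound `1 / (1 + z) ≤ e^z Γ(0, z)`. -/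
theorem inv_one_add_le_exp_mul_Gamma0 {z : ℝ} (hz : 0 < z) :
    (1 + z)⁻¹ ≤ Real.exp z * Gamma0 z := by
  have hderiv : ∀ t ∈ Set.Ici z, HasDerivAt (fun t : ℝ => -(Real.exp (-t) * (1 + t)⁻¹))
      (Real.exp (-t) * ((2 + t) / (1 + t) ^ 2)) t := by
    intro t ht
    have ht0 : 0 < t := hz.trans_le ht
    have h1 : (1 + t) ≠ 0 := by positivity
    convert! (((hasDerivAt_id t).neg.exp).mul (((hasDerivAt_id t).const_add 1).inv h1)).neg using 1
    simp only [id, Pi.neg_apply, Pi.inv_apply]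
    field_simp
    ring
  have hnonneg : ∀ t ∈ Set.Ioi z, 0 ≤ Real.exp (-t) * ((2 + t) / (1 + t) ^ 2) := by
    intro t ht
    have ht0 : 0 < t := hz.trans ht
    positivity
  have hlim : Filter.Tendsto (fun t : ℝ => -(Real.exp (-t) * (1 + t)⁻¹)) Filter.atTop
      (nhds (-(0 * 0))) :=
    (Real.tendsto_exp_neg_atTop_nhds_zero.mul
      (Filter.tendsto_atTop_add_const_left _ 1 Filter.tendsto_id).inv_tendsto_atTop).neg
  have hval := integral_Ioi_of_hasDerivAt_of_nonneg' hderiv hnonneg hlim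
  have hle : (∫ t in Set.Ioi z, Real.exp (-t) * ((2 + t) / (1 + t) ^ 2)) ≤ Gamma0 z := by
    refine setIntegral_mono_on (integrableOn_Ioi_deriv_of_nonneg' hderiv hnonneg hlim)
      (integrableOn_Gamma0 hz) measurableSet_Ioi fun t ht => ?_
    have ht0 : 0 < t := hz.trans ht
    rw [mul_comm]
    gcongr
    rw [div_le_iff₀ (by positivity), inv_mul_eq_div, le_div_iff₀ ht0]
    nlinarith
  rw [hval] at hle
  calc (1 + z)⁻¹ = Real.exp z * (Real.exp (-z) * (1 + z)⁻¹) := by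
        rw [← mul_assoc, ← Real.exp_add]; simp
    _ ≤ Real.exp z * Gamma0 z := by
        gcongr
        linarith

/-- The function `z ↦ ln(1 + 1/z) − e^z Γ(0, z)` is decreasing on `(0, ∞)`. -/
theorem antitoneOn_log_sub_exp_mul_Gamma0 :
    AntitoneOn (fun z : ℝ => Real.log (1 + 1 / z) - Real.exp z * Gamma0 z) (Set.Ioi 0) := by
  have hderiv : ∀ z ∈ Set.Ioi (0 : ℝ),
      HasDerivAt (fun z : ℝ => Real.log (1 + 1 / z) - Real.exp z * Gamma0 z)
        ((1 + z)⁻¹ - Real.exp z * Gamma0 z) z := by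
    intro z (hz : 0 < z)
    have hlog := (((hasDerivAt_inv hz.ne').const_add 1).log (by positivity))
    simp only [one_div]
    convert! hlog.sub ((Real.hasDerivAt_exp z).mul (hasDerivAt_Gamma0 hz)) using 1
    rw [Real.exp_neg]
    have := Real.exp_pos z
    field_simp
    ring
  refine antitoneOn_of_hasDerivWithinAt_nonpos (convex_Ioi 0)
    (fun z hz => (hderiv z hz).continuousAt.continuousWithinAt)
    (fun z hz => (hderiv z (interior_subset hz)).hasDerivWithinAt) fun z hz => ?_
  linarith [inv_one_add_le_exp_mul_Gamma0 (interior_subset hz : z ∈ Set.Ioi (0 : ℝ))]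

/-- For every `ρ > 0` and `0 < β < 1`,
`ln(1 + ρ) − ln(1 + ρβ) ≥ e^{1/ρ} Γ(0, 1/ρ) − e^{1/(ρβ)} Γ(0, 1/(ρβ))`. -/
theorem log_sub_log_ge_expGamma0_sub (ρ β : ℝ) (hρ : 0 < ρ) (hβ0 : 0 < β) (hβ1 : β < 1) :
    Real.log (1 + ρ) - Real.log (1 + ρ * β)
      ≥ Real.exp (1 / ρ) * Gamma0 (1 / ρ) - Real.exp (1 / (ρ * β)) * Gamma0 (1 / (ρ * β)) := by
  have hρβ : 0 < ρ * β := mul_pos hρ hβ0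
  have hle : 1 / ρ ≤ 1 / (ρ * β) :=
    one_div_le_one_div_of_le hρβ (mul_le_of_le_one_right hρ.le hβ1.le)
  have h := antitoneOn_log_sub_exp_mul_Gamma0 (Set.mem_Ioi.2 (one_div_pos.2 hρ))
    (Set.mem_Ioi.2 (one_div_pos.2 hρβ)) hle
  simp only [one_div_one_div] at h
  linarith
end

section
/- For every y > 0, the strict inequality e^{-y} / (1 + y) < Γ(0, y) holds, where Γ(0, y) = ∫_y^∞ t^{-1} e^{-t} dt. -/
open Real MeasureTheory

theorem integrableOn_inv_mul_exp_neg_Ioi {y : ℝ} (hy : 0 < y) :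
    IntegrableOn (fun t : ℝ => t⁻¹ * Real.exp (-t)) (Set.Ioi y) := by
  refine Integrable.mono' ((integrableOn_exp_neg_Ioi y).const_mul y⁻¹)
    (by fun_prop : Measurable fun t : ℝ => t⁻¹ * Real.exp (-t)).aestronglyMeasurable ?_
  filter_upwards [ae_restrict_mem measurableSet_Ioi] with t (ht : y < t)
  have ht0 : 0 < t := hy.trans ht
  rw [Real.norm_of_nonneg (by positivity)]
  gcongr

theorem hasDerivAt_neg_exp_neg_div_one_add {t : ℝ} (ht : 1 + t ≠ 0) :
    HasDerivAt (fun t : ℝ => -(Real.exp (-t) / (1 + t)))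
      ((t + 2) / (1 + t) ^ 2 * Real.exp (-t)) t := by
  refine (((hasDerivAt_neg t).exp).div ((hasDerivAt_id' t).const_add 1) ht).neg.congr_deriv ?_
  field_simp
  ring

theorem tendsto_neg_exp_neg_div_one_add_atTop :
    Filter.Tendsto (fun t : ℝ => -(Real.exp (-t) / (1 + t))) Filter.atTop (nhds 0) := by
  simpa using (Real.tendsto_exp_neg_atTop_nhds_zero.div_atTop
    (Filter.tendsto_atTop_add_const_left _ (1 : ℝ) Filter.tendsto_id)).neg

theorem add_two_div_one_add_sq_lt_inv {t : ℝ} (ht : 0 < t) :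
    (t + 2) / (1 + t) ^ 2 < t⁻¹ := by
  rw [← one_div, div_lt_div_iff₀ (by positivity) ht]
  linarith

/-- For every `y > 0`, the strict inequality `e^{-y} / (1 + y) < Γ(0, y)` holds. -/
theorem exp_neg_div_lt_Gamma0 (y : ℝ) (hy : 0 < y) :
    Real.exp (-y) / (1 + y) < Gamma0 y := by
  have hderiv : ∀ t ∈ Set.Ici y, HasDerivAt (fun t : ℝ => -(Real.exp (-t) / (1 + t)))
      ((t + 2) / (1 + t) ^ 2 * Real.exp (-t)) t := fun t ht =>
    hasDerivAt_neg_exp_neg_div_one_add (by linarith [Set.mem_Ici.mp ht])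
  have hpos : ∀ t ∈ Set.Ioi y, 0 ≤ (t + 2) / (1 + t) ^ 2 * Real.exp (-t) := fun t ht => by
    have : 0 < t := hy.trans ht
    positivity
  have hint := integrableOn_Ioi_deriv_of_nonneg' hderiv hpos tendsto_neg_exp_neg_div_one_add_atTop
  have hval := integral_Ioi_of_hasDerivAt_of_tendsto' hderiv hint
    tendsto_neg_exp_neg_div_one_add_atTop
  rw [zero_sub, neg_neg] at hval
  have hlt : ∀ t ∈ Set.Ioi y,
      0 < t⁻¹ * Real.exp (-t) - (t + 2) / (1 + t) ^ 2 * Real.exp (-t) := fun t ht =>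
    sub_pos.mpr (mul_lt_mul_of_pos_right (add_two_div_one_add_sq_lt_inv (hy.trans ht))
      (Real.exp_pos _))
  have hf := integrableOn_inv_mul_exp_neg_Ioi hy
  rw [Gamma0, ← hval, ← sub_pos, ← integral_sub hf hint]
  refine (setIntegral_pos_iff_support_of_nonneg_ae ?_ (hf.sub hint)).mpr ?_
  · filter_upwards [ae_restrict_mem measurableSet_Ioi] with t ht using (hlt t ht).le
  · refine lt_of_lt_of_le ?_ (measure_mono fun t ht => ⟨(hlt t ht).ne', ht⟩)
    simp
end

section
/- For every y > 0, the strict inequality (1/2) e^{-y} ln(1 + 2/y) < Γ(0, y) holds, where Γ(0, y) = ∫_y^∞ t^{-1} e^{-t} dt. -/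
open Real MeasureTheory

theorem log_one_add_two_div_lt {t : ℝ} (ht : 0 < t) :
    Real.log (1 + 2 / t) < 2 / t - 2 / (t * (t + 2)) := by
  have hu : 1 < 1 + 2 / t := by linarith [div_pos two_pos ht]
  have h := Real.self_lt_sinh_iff.2 (Real.log_pos hu)
  rw [Real.sinh_log (by positivity)] at h
  convert h using 1
  field_simp
  ring

theorem hasDerivAt_half_exp_neg_log {t : ℝ} (ht : 0 < t) :
    HasDerivAt (fun t => 1 / 2 * Real.exp (-t) * Real.log (1 + 2 / t))
      (-(1 / 2 * Real.exp (-t) * (Real.log (1 + 2 / t) + 2 / (t * (t + 2))))) t := by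
  have hu : (1 + 2 / t : ℝ) ≠ 0 := by positivity
  have h1 := ((hasDerivAt_neg t).exp).const_mul (1 / 2)
  have h2 : HasDerivAt (fun t : ℝ => 1 + 2 / t) (2 * -(t ^ 2)⁻¹) t := by
    simpa only [div_eq_mul_inv] using ((hasDerivAt_inv ht.ne').const_mul 2).const_add 1
  refine (h1.mul (h2.log hu)).congr_deriv ?_
  field_simp
  ring

theorem tendsto_half_exp_neg_log :
    Filter.Tendsto (fun t => 1 / 2 * Real.exp (-t) * Real.log (1 + 2 / t))
      Filter.atTop (nhds 0) := by
  have h1 : Filter.Tendsto (fun t : ℝ => 1 + 2 / t) Filter.atTop (nhds (1 + 0)) :=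
    (Filter.tendsto_id.const_div_atTop 2).const_add 1
  have h2 := (Real.tendsto_exp_neg_atTop_nhds_zero.const_mul (1 / 2)).mul
    (h1.log (by norm_num))
  simpa using h2

theorem integrableOn_Ioi_inv_mul_exp_neg {y : ℝ} (hy : 0 < y) :
    IntegrableOn (fun t => t⁻¹ * Real.exp (-t)) (Set.Ioi y) := by
  refine ((integrableOn_exp_neg_Ioi y).const_mul y⁻¹).mono'
    (by fun_prop) ((ae_restrict_mem measurableSet_Ioi).mono fun t ht => ?_)
  have ht' : y < t := ht
  have ht0 := hy.trans ht'
  rw [Real.norm_of_nonneg (by positivity)]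
  gcongr

/-- For every `y > 0`, the strict inequality `(1/2) e^{-y} ln(1 + 2/y) < Γ(0, y)` holds. -/
theorem half_exp_neg_log_lt_Gamma0 (y : ℝ) (hy : 0 < y) :
    1 / 2 * Real.exp (-y) * Real.log (1 + 2 / y) < Gamma0 y := by
  set g : ℝ → ℝ := fun t =>
    -(1 / 2 * Real.exp (-t) * (Real.log (1 + 2 / t) + 2 / (t * (t + 2)))) with hg
  have hderiv : ∀ t ∈ Set.Ici y,
      HasDerivAt (fun t => 1 / 2 * Real.exp (-t) * Real.log (1 + 2 / t)) (g t) t :=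
    fun t ht => hasDerivAt_half_exp_neg_log (hy.trans_le ht)
  have hneg : ∀ t ∈ Set.Ioi y, g t ≤ 0 := fun t ht => by
    have ht0 : 0 < t := hy.trans ht
    have hlog : 0 ≤ Real.log (1 + 2 / t) :=
      Real.log_nonneg (by linarith [div_pos two_pos ht0])
    exact neg_nonpos.2 (by positivity)
  have hint := integrableOn_Ioi_deriv_of_nonpos' hderiv hneg tendsto_half_exp_neg_log
  have hval := integral_Ioi_of_hasDerivAt_of_nonpos' hderiv hneg tendsto_half_exp_neg_log
  have hf := integrableOn_Ioi_inv_mul_exp_neg hy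
  have hpos : ∀ t ∈ Set.Ioi y, 0 < t⁻¹ * Real.exp (-t) + g t := fun t ht => by
    have h := mul_pos (Real.exp_pos (-t)) (sub_pos.2 (log_one_add_two_div_lt (hy.trans ht)))
    simp only [hg]
    linear_combination (1 / 2) * h
  have hlt : 0 < ∫ t in Set.Ioi y, (t⁻¹ * Real.exp (-t) + g t) := by
    rw [setIntegral_pos_iff_support_of_nonneg_ae
      ((ae_restrict_mem measurableSet_Ioi).mono fun t ht => (hpos t ht).le) (hf.add hint),
      Set.inter_eq_right.2 (fun t ht => Function.mem_support.2 (hpos t ht).ne')]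
    simp
  rw [integral_add hf hint, hval] at hlt
  unfold Gamma0
  linarith
end

section
/- The function h(y) = (1/2)(1 + y) ln(1 + 2/y) − 1 is strictly monotonically decreasing on (0, ∞); moreover h(y) → +∞ as y → 0⁺ and h(y) → 0 as y → ∞. -/
open Real Filter

/-- For `x > 1`, `log x < (x - x⁻¹) / 2`. -/
theorem log_lt_half_sub_inv {x : ℝ} (hx : 1 < x) : Real.log x < (x - x⁻¹) / 2 := by
  rw [← Real.sinh_log (by linarith)]
  exact Real.self_lt_sinh_iff.2 (Real.log_pos hx)

theorem hasDerivAt_half_one_add_log {y : ℝ} (hy : 0 < y) :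
    HasDerivAt (fun y : ℝ => 1 / 2 * (1 + y) * Real.log (1 + 2 / y) - 1)
      (1 / 2 * (Real.log (1 + 2 / y) - ((1 + 2 / y) - (1 + 2 / y)⁻¹) / 2)) y := by
  have hx : 1 + 2 / y ≠ 0 := by positivity
  have hlog := (((hasDerivAt_const y (2 : ℝ)).div (hasDerivAt_id y) hy.ne').const_add 1).log hx
  have h := ((((hasDerivAt_id y).const_add 1).const_mul (1 / 2)).mul hlog).sub_const 1
  refine h.congr_deriv ?_
  simp only [id, Pi.div_apply]
  have h2 : y + 2 ≠ 0 := by positivity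
  field_simp
  ring

/-- The function `h(y) = (1/2)(1 + y) ln(1 + 2/y) − 1` is strictly monotonically decreasing on
`(0, ∞)`; moreover `h(y) → +∞` as `y → 0⁺` and `h(y) → 0` as `y → ∞`. -/
theorem strictAntiOn_half_one_add_log :
    StrictAntiOn (fun y : ℝ => 1 / 2 * (1 + y) * Real.log (1 + 2 / y) - 1) (Set.Ioi 0)
      ∧ Tendsto (fun y : ℝ => 1 / 2 * (1 + y) * Real.log (1 + 2 / y) - 1)
          (nhdsWithin 0 (Set.Ioi 0)) atTop
      ∧ Tendsto (fun y : ℝ => 1 / 2 * (1 + y) * Real.log (1 + 2 / y) - 1)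
          atTop (nhds 0) := by
  refine ⟨?_, ?_, ?_⟩
  · refine strictAntiOn_of_deriv_neg (convex_Ioi 0)
      (fun y hy => (hasDerivAt_half_one_add_log hy).continuousAt.continuousWithinAt) ?_
    intro y hy
    rw [interior_Ioi] at hy
    have hy : 0 < y := hy
    have hx : 1 < 1 + 2 / y := lt_add_of_pos_right 1 (by positivity)
    rw [(hasDerivAt_half_one_add_log hy).deriv]
    linarith [log_lt_half_sub_inv hx]
  · have hfactor : Tendsto (fun y : ℝ => 1 / 2 * (1 + y)) (nhdsWithin 0 (Set.Ioi 0))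
        (nhds (1 / 2)) :=
      ((by fun_prop : Continuous fun y : ℝ => 1 / 2 * (1 + y)).tendsto' 0 _
        (by norm_num)).mono_left nhdsWithin_le_nhds
    have hlog : Tendsto (fun y : ℝ => Real.log (1 + 2 / y)) (nhdsWithin 0 (Set.Ioi 0)) atTop :=
      Real.tendsto_log_atTop.comp <| tendsto_atTop_add_const_left _ 1 <| by
        exact (tendsto_inv_nhdsGT_zero.const_mul_atTop two_pos).congr
          fun y => (div_eq_mul_inv 2 y).symm
    exact tendsto_atTop_add_const_right _ (-1) (hfactor.pos_mul_atTop (by norm_num) hlog)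
  · have hdiv : Tendsto (fun y : ℝ => 1 + 2 / y) atTop (nhds 1) := by
      simpa using (tendsto_id.const_div_atTop (2 : ℝ)).const_add 1
    have hlog : Tendsto (fun y : ℝ => Real.log (1 + 2 / y)) atTop (nhds 0) := by
      simpa using hdiv.log one_ne_zero
    have hmul := Real.tendsto_mul_log_one_add_div_atTop 2
    have h := ((hlog.add hmul).const_mul (1 / 2)).sub_const 1
    convert h using 2
    · ring
    · norm_num
end

section
/- For ρ > 0, 0 < α < 1, and β = 1 − α, the function x ↦ ln(1 + ρ α x / (1 + ρ β x)) is concave on [0, ∞). -/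
open Real

/-- The saturating function `x ↦ k x / (1 + c x)` is concave on `[0, ∞)` for `k, c ≥ 0`. -/
theorem concaveOn_mul_div_one_add_mul {k c : ℝ} (hk : 0 ≤ k) (hc : 0 ≤ c) :
    ConcaveOn ℝ (Set.Ici 0) (fun x : ℝ => k * x / (1 + c * x)) := by
  refine ⟨convex_Ici 0, ?_⟩
  intro x hx y hy a b ha hb hab
  rw [Set.mem_Ici] at hx hy
  simp only [smul_eq_mul]
  have hu : 0 < 1 + c * x := by positivity
  have hv : 0 < 1 + c * y := by positivity
  have hw : 0 < 1 + c * (a * x + b * y) := by positivity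
  obtain rfl : b = 1 - a := by linarith
  have key : k * (a * x + (1 - a) * y) / (1 + c * (a * x + (1 - a) * y)) -
      (a * (k * x / (1 + c * x)) + (1 - a) * (k * y / (1 + c * y))) =
      k * c * a * (1 - a) * (x - y) ^ 2 /
        ((1 + c * x) * (1 + c * y) * (1 + c * (a * x + (1 - a) * y))) := by
    field_simp
    ring
  rw [← sub_nonneg, key]
  positivity

/-- The logarithm of a positive concave function is concave. -/
theorem ConcaveOn.real_log {s : Set ℝ} {f : ℝ → ℝ} (hf : ConcaveOn ℝ s f)
    (hpos : ∀ x ∈ s, 0 < f x) : ConcaveOn ℝ s (fun x => Real.log (f x)) := by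
  refine ⟨hf.1, ?_⟩
  intro x hx y hy a b ha hb hab
  have hlog := strictConcaveOn_log_Ioi.concaveOn
  have hmem : 0 < a • f x + b • f y := hlog.1 (hpos x hx) (hpos y hy) ha hb hab
  exact (hlog.2 (hpos x hx) (hpos y hy) ha hb hab).trans
    (Real.log_le_log hmem (hf.2 hx hy ha hb hab))

/-- For `ρ > 0`, `0 < α < 1`, and `β = 1 − α`, the function
`x ↦ ln(1 + ραx/(1 + ρβx))` is concave on `[0, ∞)`. -/
theorem concaveOn_rate (ρ α β : ℝ) (hρ : 0 < ρ) (hα0 : 0 < α) (hα1 : α < 1) (hβ : β = 1 - α) :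
    ConcaveOn ℝ (Set.Ici 0)
      (fun x : ℝ => Real.log (1 + ρ * α * x / (1 + ρ * β * x))) := by
  have hβ0 : 0 < β := by linarith
  refine ConcaveOn.real_log ((concaveOn_const 1 (convex_Ici 0)).add
    (concaveOn_mul_div_one_add_mul (by positivity) (by positivity))) ?_
  intro x hx
  rw [Set.mem_Ici] at hx
  positivity
end
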